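/- Let N_t be the Ornstein–Uhlenbeck semigroup N_t h(x) = ∫_ℝ h(e^{-t}x + √(1−e^{-2t}) y) e^{-πy²} dy. If h : ℝ → ℝ₊ is in L¹(ℝ, e^{-πx²}dx) and has finite entropy S(h) = ∫ h log h e^{-πx²} dx, then for all t ≥ 0, S(N_t h) ≤ e^{-2t} S(h) + (1 − e^{-2t}) ‖h‖₁ log ‖h‖₁, where ‖h‖₁ = ∫ h e^{-πx²} dx. -/

import Mathlib

open MeasureTheory Real

namespace OUEntropy

open Filter Topology ProbabilityTheory

/-- The variance of the Gaussian with density `exp (-π x²)`. -/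
noncomputable def gv : NNReal := ⟨1 / (2 * π), by positivity⟩

/-- The Gaussian probability measure with density `exp (-π x²)`. -/
noncomputable def gm : Measure ℝ := gaussianReal 0 gv

instance : IsProbabilityMeasure gm := by unfold gm; infer_instance

lemma gv_ne : gv ≠ 0 := by
  intro h
  have : (gv : ℝ) = 0 := by rw [h]; rfl
  have h2 : (0 : ℝ) < 1 / (2 * π) := by positivity
  exact h2.ne' this

lemma pdf_eq (x : ℝ) : gaussianPDFReal 0 gv x = exp (-π * x ^ 2) := by
  have h : (gv : ℝ) = 1 / (2 * π) := rfl
  have hp := pi_pos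
  rw [gaussianPDFReal, h]
  have h1 : 2 * π * (1 / (2 * π)) = 1 := by field_simp
  rw [h1, sqrt_one, inv_one, one_mul]
  congr 1
  field_simp
  ring

lemma gm_eq : gm = volume.withDensity (fun x => ENNReal.ofReal (exp (-π * x ^ 2))) := by
  rw [gm, gaussianReal_of_var_ne_zero _ gv_ne]
  congr 1
  ext x
  rw [gaussianPDF, pdf_eq]

lemma gm_integral (f : ℝ → ℝ) : ∫ x, f x ∂gm = ∫ x, f x * exp (-π * x ^ 2) := by
  rw [gm, integral_gaussianReal_eq_integral_smul gv_ne]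
  congr 1
  ext x
  rw [pdf_eq, smul_eq_mul, mul_comm]

lemma gm_integrable (f : ℝ → ℝ) :
    Integrable f gm ↔ Integrable (fun x => f x * exp (-π * x ^ 2)) := by
  rw [gm_eq, integrable_withDensity_iff (by fun_prop) (by simp)]
  simp only [ENNReal.toReal_ofReal (exp_pos _).le]

lemma gm_lintegral (f : ℝ → ENNReal) (hf : Measurable f) :
    ∫⁻ x, f x ∂gm = ∫⁻ x, ENNReal.ofReal (exp (-π * x ^ 2)) * f x := by
  rw [gm_eq, lintegral_withDensity_eq_lintegral_mul _ (by fun_prop) hf]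
  rfl

lemma integrable_id_gm : Integrable (fun x : ℝ => x) gm :=
  (memLp_id_gaussianReal (μ := 0) (v := gv) 1).integrable (by simp)

lemma integral_id_gm : ∫ x, x ∂gm = 0 := integral_id_gaussianReal

lemma gm_rot (ρ s : ℝ) (h : ρ ^ 2 + s ^ 2 = 1) :
    MeasurePreserving (fun p : ℝ × ℝ => (ρ * p.1 + s * p.2, -s * p.1 + ρ * p.2))
      (gm.prod gm) (gm.prod gm) := by
  obtain ⟨θ, hc, hs⟩ : ∃ θ, cos θ = ρ ∧ sin θ = s := by
    refine ⟨Complex.arg ⟨ρ, s⟩, ?_, ?_⟩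
    · have hn : ‖(⟨ρ, s⟩ : ℂ)‖ = 1 := by
        rw [Complex.norm_def, Complex.normSq_mk, ← sq, ← sq, h, sqrt_one]
      rw [Complex.cos_arg, hn, div_one]
      intro h0
      rw [h0] at hn
      simp at hn
    · have hn : ‖(⟨ρ, s⟩ : ℂ)‖ = 1 := by
        rw [Complex.norm_def, Complex.normSq_mk, ← sq, ← sq, h, sqrt_one]
      rw [Complex.sin_arg, hn, div_one]
  refine ⟨by fun_prop, ?_⟩
  have key := IsGaussian.map_rotation_eq_self_of_forall_strongDual_eq_zero
    (μ := gaussianReal 0 gv) (by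
      intro L
      have : ∀ x, L x = x * L 1 := fun x => by
        have := L.map_smul x 1
        simpa using this
      rw [integral_congr_ae (Eventually.of_forall this), integral_mul_const]
      simp [integral_id_gaussianReal]) θ
  have he : (fun p : ℝ × ℝ => (ρ * p.1 + s * p.2, -s * p.1 + ρ * p.2))
      = ContinuousLinearMap.rotation θ := by
    ext p <;> simp [ContinuousLinearMap.rotation_apply, hc, hs]
  rw [he]
  exact key

lemma gm_neg : MeasurePreserving (fun x : ℝ => -x) gm gm :=
  ⟨by fun_prop, by rw [gm, gaussianReal_map_neg, neg_zero]⟩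

lemma cdf_props (f : ℝ → ℝ) (hf : Continuous f) (hpos : ∀ x, 0 < f x) (hi : Integrable f)
    (h1 : ∫ x, f x = 1) :
    ∃ F : ℝ → ℝ, (∀ x, HasDerivAt F (f x) x) ∧ StrictMono F ∧ Set.range F = Set.Ioo 0 1 := by
  let F : ℝ → ℝ := fun u => (∫ x in Set.Iic 0, f x) + ∫ x in (0:ℝ)..u, f x
  have hd : ∀ x, HasDerivAt F (f x) x := fun x =>
    (intervalIntegral.integral_hasDerivAt_right (hf.intervalIntegrable _ _)
      hf.aestronglyMeasurable.stronglyMeasurableAtFilter hf.continuousAt).const_add _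
  have hm : StrictMono F := strictMono_of_hasDerivAt_pos hd hpos
  have hc : Continuous F := continuous_iff_continuousAt.2 fun x => (hd x).continuousAt
  have ht : Tendsto F atTop (𝓝 1) := by
    have := (intervalIntegral_tendsto_integral_Ioi 0 hi.integrableOn tendsto_id).const_add
      (∫ x in Set.Iic 0, f x)
    rw [intervalIntegral.integral_Iic_add_Ioi hi.integrableOn hi.integrableOn, h1] at this
    exact this
  have hb : Tendsto F atBot (𝓝 0) := by
    have := (intervalIntegral_tendsto_integral_Iic 0 hi.integrableOn tendsto_id).const_sub
      (∫ x in Set.Iic 0, f x)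
    rw [sub_self] at this
    refine this.congr fun x => ?_
    simp only [F, id]
    rw [intervalIntegral.integral_symm x 0]
    ring
  refine ⟨F, hd, hm, ?_⟩
  ext y
  constructor
  · rintro ⟨x, rfl⟩
    exact ⟨(hm.monotone.le_of_tendsto hb (x - 1)).trans_lt (hm (by linarith)),
      (hm (by linarith : x < x + 1)).trans_le (hm.monotone.ge_of_tendsto ht (x + 1))⟩
  · intro hy
    refine mem_range_of_exists_le_of_exists_ge hc ?_ ?_
    · exact ((hb.eventually_lt_const hy.1).exists).imp fun _ h => h.le
    · exact ((ht.eventually_const_lt hy.2).exists).imp fun _ h => h.le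

lemma transport (f g : ℝ → ℝ) (hf : Continuous f) (hfpos : ∀ x, 0 < f x) (hfi : Integrable f)
    (hf1 : ∫ x, f x = 1) (hg : Continuous g) (hgpos : ∀ x, 0 < g x) (hgi : Integrable g)
    (hg1 : ∫ x, g x = 1) :
    ∃ T T' : ℝ → ℝ, (∀ x, HasDerivAt T (T' x) x) ∧ (∀ x, 0 < T' x) ∧
      (∀ x, g (T x) * T' x = f x) := by
  obtain ⟨F, hFd, hFm, hFr⟩ := cdf_props f hf hfpos hfi hf1
  obtain ⟨G, hGd, hGm, hGr⟩ := cdf_props g hg hgpos hgi hg1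
  have hGo : IsOpenEmbedding G :=
    ⟨hGm.isEmbedding_of_ordConnected (by rw [hGr]; exact Set.ordConnected_Ioo),
      by rw [hGr]; exact isOpen_Ioo⟩
  let e := hGo.toOpenPartialHomeomorph
  have hmem : ∀ x, F x ∈ e.target := fun x => by
    have : F x ∈ Set.range G := by rw [hGr, ← hFr]; exact ⟨x, rfl⟩
    simpa [e] using this
  have hright : ∀ x, G (e.symm (F x)) = F x := fun x => e.right_inv (hmem x)
  refine ⟨fun x => e.symm (F x), fun x => (g (e.symm (F x)))⁻¹ * f x, ?_, ?_, ?_⟩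
  · intro x
    have h1 := e.hasDerivAt_symm (hmem x) (hgpos _).ne' (hGd (e.symm (F x)))
    exact h1.comp x (hFd x)
  · intro x
    have := hgpos (e.symm (F x))
    have := hfpos x
    positivity
  · intro x
    have := hgpos (e.symm (F x))
    field_simp

/-- The Ornstein-Uhlenbeck averaging operator. -/
noncomputable def N (ρ s : ℝ) (φ : ℝ → ℝ) (x : ℝ) : ℝ := ∫ y, φ (ρ * x + s * y) ∂gm

lemma N_bound (ρ s : ℝ) {φ : ℝ → ℝ} {M : ℝ} (hM : ∀ x, |φ x| ≤ M) (x : ℝ) :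
    |N ρ s φ x| ≤ M := by
  have := norm_integral_le_of_norm_le_const (μ := gm) (f := fun y => φ (ρ * x + s * y)) (C := M)
    (Eventually.of_forall fun y => hM _)
  simpa [N] using this

lemma N_meas (ρ s : ℝ) {φ : ℝ → ℝ} (hφ : Measurable φ) : Measurable (N ρ s φ) := by
  have : StronglyMeasurable (fun p : ℝ × ℝ => φ (ρ * p.1 + s * p.2)) :=
    (hφ.comp (by fun_prop)).stronglyMeasurable
  exact this.integral_prod_right.measurable

lemma N_cont (ρ s : ℝ) (hs : s ≠ 0) {φ : ℝ → ℝ} (hφ : Measurable φ) {M : ℝ}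
    (hM : ∀ x, |φ x| ≤ M) : Continuous (N ρ s φ) := by
  have h0 : ∀ x, N ρ s φ x = ∫ w, φ (s * w) * exp (-π * (w - ρ * x / s) ^ 2) := by
    intro x
    rw [N, gm_integral, ← integral_sub_right_eq_self _ (ρ * x / s)]
    congr 1
    ext w
    congr 2
    field_simp
    ring
  have h1 : N ρ s φ = fun x => ∫ w, φ (s * w) * exp (-π * (w - ρ * x / s) ^ 2) := funext h0
  have hM0 : 0 ≤ M := (abs_nonneg _).trans (hM 0)
  rw [h1, continuous_iff_continuousAt]
  intro x0
  have hev : ∀ᶠ x in 𝓝 x0, (ρ * x / s) ^ 2 < (ρ * x0 / s) ^ 2 + 1 := by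
    have : ContinuousAt (fun x => (ρ * x / s) ^ 2) x0 := by fun_prop
    exact this.eventually_lt_const (by linarith)
  refine continuousAt_of_dominated (bound := fun w =>
    M * exp (π * ((ρ * x0 / s) ^ 2 + 1)) * exp (-(π / 2) * w ^ 2)) ?_ ?_ ?_ ?_
  · refine Eventually.of_forall fun x => Measurable.aestronglyMeasurable ?_
    exact (hφ.comp (by fun_prop)).mul (by fun_prop)
  · filter_upwards [hev] with x hx
    refine Eventually.of_forall fun w => ?_
    rw [norm_mul, norm_eq_abs, norm_of_nonneg (exp_pos _).le, mul_assoc, ← exp_add]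
    refine mul_le_mul (hM _) (exp_le_exp.2 ?_) (exp_pos _).le hM0
    have hp := pi_pos
    nlinarith [mul_nonneg hp.le (sq_nonneg (w - 2 * (ρ * x / s))), mul_lt_mul_of_pos_left hx hp]
  · exact (integrable_exp_neg_mul_sq (by positivity)).const_mul _
  · refine Eventually.of_forall fun w => ?_
    fun_prop

lemma gm_univ_exp : ∫ x : ℝ, exp (-π * x ^ 2) = 1 := by
  have := gm_integral (fun _ => 1)
  simp only [integral_const, one_mul, probReal_univ, smul_eq_mul, mul_one] at this
  exact this.symm

lemma gm_integrable_exp : Integrable (fun x : ℝ => exp (-π * x ^ 2)) :=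
  integrable_exp_neg_mul_sq pi_pos

lemma integrable_bdd {α : Type*} [MeasurableSpace α] (μ : Measure α) [IsProbabilityMeasure μ]
    {f : α → ℝ} (hf : Measurable f) {M : ℝ} (hM : ∀ x, |f x| ≤ M) : Integrable f μ :=
  Integrable.of_bound hf.aestronglyMeasurable M (Eventually.of_forall hM)

/-- Change of variables bound. -/
lemma cov_bound (ρ s : ℝ) (hρ : 0 < ρ) (hs : s ≠ 0) (T T' : ℝ → ℝ)
    (hT : ∀ x, HasDerivAt T (T' x) x) (hT' : ∀ x, 0 < T' x) (F : ℝ → ENNReal) (z : ℝ) :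
    ∫⁻ x, ENNReal.ofReal (ρ ^ 2 * T' (ρ * x + -s * z) + s ^ 2) *
      F (ρ * T (ρ * x + -s * z) + s * (- -s * x + ρ * z)) ≤ ∫⁻ u, F u := by
  set Θ : ℝ → ℝ := fun x => ρ * T (ρ * x + -s * z) + s * (- -s * x + ρ * z) with hΘ
  have hpos : ∀ x, 0 < ρ ^ 2 * T' (ρ * x + -s * z) + s ^ 2 := fun x => by
    have := hT' (ρ * x + -s * z)
    positivity
  have hd : ∀ x, HasDerivAt Θ (ρ ^ 2 * T' (ρ * x + -s * z) + s ^ 2) x := by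
    intro x
    have h1 : HasDerivAt (fun x => ρ * x + -s * z) ρ x := by
      simpa using ((hasDerivAt_id x).const_mul ρ).add_const (-s * z)
    have h2 := ((hT (ρ * x + -s * z)).comp x h1).const_mul ρ
    have h3 : HasDerivAt (fun x => s * (- -s * x + ρ * z)) (s * s) x := by
      simpa using (((hasDerivAt_id x).const_mul (- -s)).add_const (ρ * z)).const_mul s
    have he : ρ ^ 2 * T' (ρ * x + -s * z) + s ^ 2 = ρ * (T' (ρ * x + -s * z) * ρ) + s * s := by
      ring
    rw [he]
    exact h2.add h3
  have hinj : Function.Injective Θ := (strictMono_of_hasDerivAt_pos hd hpos).injective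
  have := lintegral_image_eq_lintegral_abs_deriv_mul MeasurableSet.univ
    (fun x _ => (hd x).hasDerivWithinAt) hinj.injOn F
  rw [Measure.restrict_univ] at this
  simp_rw [abs_of_pos (hpos _)] at this
  rw [← this]
  exact setLIntegral_le_lintegral _ _

lemma star (ρ s : ℝ) (hρ : 0 < ρ) (hs : s ≠ 0) (h : ρ ^ 2 + s ^ 2 = 1) {φ : ℝ → ℝ}
    (hφ : Measurable φ) {M : ℝ} (hM : ∀ x, |φ x| ≤ M) :
    ρ ^ 2 * log (∫ x, exp (N ρ s φ x / ρ ^ 2) ∂gm) ≤ log (∫ x, exp (φ x) ∂gm) := by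
  set C := ∫ x, exp (N ρ s φ x / ρ ^ 2) ∂gm with hC
  set Q := ∫ x, exp (φ x) ∂gm with hQ
  have hρ2 : 0 < ρ ^ 2 := by positivity
  have hNc := N_cont ρ s hs hφ hM
  have hNb := N_bound ρ s hM
  have hEc : Continuous (fun x => exp (N ρ s φ x / ρ ^ 2)) := by fun_prop
  have hEb : ∀ x, |exp (N ρ s φ x / ρ ^ 2)| ≤ exp (M / ρ ^ 2) := fun x => by
    rw [abs_of_pos (exp_pos _)]
    exact exp_le_exp.2 (div_le_div_of_nonneg_right ((le_abs_self _).trans (hNb x)) hρ2.le)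
  have hEi := integrable_bdd gm hEc.measurable hEb
  have hPb : ∀ x, |exp (φ x)| ≤ exp M := fun x => by
    rw [abs_of_pos (exp_pos _)]
    exact exp_le_exp.2 ((le_abs_self _).trans (hM x))
  have hPi := integrable_bdd gm hφ.exp hPb
  have hCpos : 0 < C := integral_exp_pos hEi
  have hQpos : 0 < Q := integral_exp_pos hPi
  set k : ℝ → ℝ := fun x => exp (N ρ s φ x / ρ ^ 2) / C with hk
  have hkc : Continuous k := hEc.div_const _
  have hkpos : ∀ x, 0 < k x := fun x => div_pos (exp_pos _) hCpos
  have hki : Integrable k gm := hEi.div_const _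
  obtain ⟨T, T', hT, hT', hTe⟩ := transport (fun x => exp (-π * x ^ 2))
    (fun x => k x * exp (-π * x ^ 2)) (by fun_prop) (fun x => exp_pos _) gm_integrable_exp
    gm_univ_exp (by fun_prop) (fun x => mul_pos (hkpos x) (exp_pos _))
    ((gm_integrable k).1 hki) (by rw [← gm_integral, integral_div, div_self hCpos.ne'])
  have hTc : Continuous T := continuous_iff_continuousAt.2 fun x => (hT x).continuousAt
  have hTi : Integrable T gm := by
    have hinj : Function.Injective T := (strictMono_of_hasDerivAt_pos hT hT').injective
    have h1 : Integrable (fun u => u * k u) gm :=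
      integrable_id_gm.mul_bdd (c := exp (M / ρ ^ 2) / C) hkc.aestronglyMeasurable
        (Eventually.of_forall fun x => by
          rw [norm_eq_abs, hk, abs_div, abs_of_pos hCpos]
          exact div_le_div_of_nonneg_right (hEb x) hCpos.le)
    have h2 := (integrableOn_image_iff_integrableOn_abs_deriv_smul MeasurableSet.univ
      (fun x _ => (hT x).hasDerivWithinAt) hinj.injOn _).1
      ((gm_integrable _).1 h1).integrableOn
    rw [integrableOn_univ] at h2
    rw [gm_integrable]
    refine h2.congr (Eventually.of_forall fun x => ?_)
    simp only [smul_eq_mul, abs_of_pos (hT' x), ← hTe x]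
    ring
  set B : ℝ × ℝ → ℝ := fun p => φ (ρ * T p.1 + s * p.2) - N ρ s φ (T p.1) + ρ ^ 2 * log C
    - 2 * π * ρ * s * ((T p.1 - p.1) * p.2) with hB
  have hBm : Measurable B := by
    have h1 : Measurable (fun p : ℝ × ℝ => φ (ρ * T p.1 + s * p.2)) := hφ.comp (by fun_prop)
    have h2 : Continuous (fun p : ℝ × ℝ => N ρ s φ (T p.1)) := by fun_prop
    have h3 : Continuous (fun p : ℝ × ℝ => 2 * π * ρ * s * ((T p.1 - p.1) * p.2)) := by fun_prop
    exact ((h1.sub h2.measurable).add_const _).sub h3.measurable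
  have hBi : Integrable B (gm.prod gm) := by
    refine Integrable.sub (Integrable.add (Integrable.sub ?_ ?_) (integrable_const _))
      (Integrable.const_mul ?_ _)
    · exact integrable_bdd _ (hφ.comp (by fun_prop)) (fun p => hM _)
    · exact integrable_bdd _ (Continuous.measurable (by fun_prop)) (fun p => hNb _)
    · exact (hTi.sub integrable_id_gm).mul_prod integrable_id_gm
  have hBint : ∫ p, B p ∂(gm.prod gm) = ρ ^ 2 * log C := by
    rw [integral_prod _ hBi]
    have : ∀ x, ∫ z, B (x, z) ∂gm = ρ ^ 2 * log C := by
      intro x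
      have i1 : Integrable (fun z => φ (ρ * T x + s * z)) gm :=
        integrable_bdd _ (hφ.comp (by fun_prop)) (fun p => hM _)
      have i2 : Integrable (fun z => φ (ρ * T x + s * z) - N ρ s φ (T x)) gm :=
        i1.sub (integrable_const _)
      have i3 : Integrable (fun z => φ (ρ * T x + s * z) - N ρ s φ (T x) + ρ ^ 2 * log C) gm :=
        i2.add (integrable_const _)
      have i4 : Integrable (fun z => 2 * π * ρ * s * ((T x - x) * z)) gm :=
        (integrable_id_gm.const_mul _).const_mul _
      simp only [hB]
      rw [integral_sub i3 i4, integral_add i2 (integrable_const _),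
        integral_sub i1 (integrable_const _), integral_const_mul (2 * π * ρ * s),
        integral_const_mul (T x - x), integral_id_gm]
      simp [N]
    simp_rw [this]
    simp
  have hexp : ∀ x z, exp (-π * x ^ 2) * exp (B (ρ * x + -s * z, - -s * x + ρ * z)) ≤
      (ρ ^ 2 * T' (ρ * x + -s * z) + s ^ 2) *
        (exp (-π * (ρ * T (ρ * x + -s * z) + s * (- -s * x + ρ * z)) ^ 2) *
          exp (φ (ρ * T (ρ * x + -s * z) + s * (- -s * x + ρ * z)))) := by
    intro x z
    obtain ⟨a, ha⟩ : ∃ a, a = ρ * x + -s * z := ⟨_, rfl⟩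
    obtain ⟨b, hb⟩ : ∃ b, b = - -s * x + ρ * z := ⟨_, rfl⟩
    have hx : x = ρ * a + s * b := by
      rw [ha, hb]; linear_combination (-x) * h
    rw [← ha, ← hb, hx]
    have hlog : log (k (T a)) = N ρ s φ (T a) / ρ ^ 2 - log C := by
      simp only [hk]
      rw [log_div (exp_pos _).ne' hCpos.ne', log_exp]
    have hle : log (k (T a)) + -π * (T a) ^ 2 + log (T' a) = -π * a ^ 2 := by
      have h1 := congrArg log (hTe a)
      rwa [log_mul (mul_pos (hkpos _) (exp_pos _)).ne' (hT' a).ne',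
        log_mul (hkpos _).ne' (exp_pos _).ne', log_exp, log_exp] at h1
    have hN : N ρ s φ (T a) = ρ ^ 2 * (log C + -π * a ^ 2 + π * (T a) ^ 2 - log (T' a)) := by
      have : N ρ s φ (T a) / ρ ^ 2 = log C + -π * a ^ 2 + π * (T a) ^ 2 - log (T' a) := by
        linarith
      rw [← this]
      field_simp
    have hgm : exp (ρ ^ 2 * log (T' a)) ≤ ρ ^ 2 * T' a + s ^ 2 := by
      have := geom_mean_le_arith_mean2_weighted hρ2.le (sq_nonneg s) (hT' a).le zero_le_one h
      rw [one_rpow, mul_one, mul_one, rpow_def_of_pos (hT' a), mul_comm (log _)] at this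
      exact this
    calc exp (-π * (ρ * a + s * b) ^ 2) * exp (B (a, b))
        = exp (ρ ^ 2 * log (T' a)) * (exp (-π * (ρ * T a + s * b) ^ 2) *
            exp (φ (ρ * T a + s * b))) := by
          rw [← exp_add, ← exp_add, ← exp_add]
          congr 1
          simp only [hB]
          rw [hN]
          ring
      _ ≤ _ := mul_le_mul_of_nonneg_right hgm (by positivity)
  have hlin : ∫⁻ p, ENNReal.ofReal (exp (B p)) ∂(gm.prod gm) ≤ ENNReal.ofReal Q := by
    have hmE : Measurable (fun p => ENNReal.ofReal (exp (B p))) := hBm.exp.ennreal_ofReal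
    have hR := gm_rot ρ (-s) (by rw [neg_sq]; exact h)
    have hmR := hmE.comp hR.measurable
    rw [← hR.lintegral_comp hmE]
    refine (lintegral_prod_symm' _ hmR).le.trans ?_
    calc _ ≤ ∫⁻ z, ENNReal.ofReal Q ∂gm := by
          refine lintegral_mono fun z => ?_
          refine (gm_lintegral _ (hmR.comp measurable_prodMk_right)).le.trans ?_
          have := cov_bound ρ s hρ hs T T' hT hT'
            (fun u => ENNReal.ofReal (exp (-π * u ^ 2) * exp (φ u))) z
          refine (lintegral_mono fun x => ?_).trans (this.trans ?_)
          · simp only [Function.comp_apply]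
            rw [← ENNReal.ofReal_mul (exp_pos _).le, ← ENNReal.ofReal_mul]
            · exact ENNReal.ofReal_le_ofReal (hexp x z)
            · have := hT' (ρ * x + -s * z)
              positivity
          · rw [hQ, gm_integral, ofReal_integral_eq_lintegral_ofReal ((gm_integrable _).1 hPi)
              (Eventually.of_forall fun x => by positivity)]
            simp_rw [mul_comm (exp (-π * _ ^ 2))]
            exact le_rfl
      _ = ENNReal.ofReal Q := by simp
  have hEBi : Integrable (fun p => exp (B p)) (gm.prod gm) := by
    refine ⟨hBm.exp.aestronglyMeasurable, ?_⟩
    rw [hasFiniteIntegral_iff_ofReal (Eventually.of_forall fun p => (exp_pos _).le)]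
    exact hlin.trans_lt ENNReal.ofReal_lt_top
  have hEBint : ∫ p, exp (B p) ∂(gm.prod gm) ≤ Q := by
    rw [integral_eq_lintegral_of_nonneg_ae (Eventually.of_forall fun p => (exp_pos _).le)
      hBm.exp.aestronglyMeasurable]
    exact ENNReal.toReal_le_of_le_ofReal hQpos.le hlin
  have hpt : ∀ p, B p ≤ exp (B p) / Q + (log Q - 1) := by
    intro p
    have := add_one_le_exp (B p - log Q)
    rw [exp_sub, exp_log hQpos] at this
    linarith
  have := integral_mono hBi ((hEBi.div_const Q).add (integrable_const _)) hpt
  rw [hBint] at this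
  simp only [Pi.add_apply] at this
  rw [integral_add (hEBi.div_const Q) (integrable_const _), integral_div] at this
  simp only [integral_const, probReal_univ, one_smul] at this
  have h2 : (∫ p, exp (B p) ∂(gm.prod gm)) / Q ≤ 1 := (div_le_one hQpos).2 hEBint
  linarith

lemma adj (ρ s : ℝ) (hρs : ρ ^ 2 + s ^ 2 = 1) {h φ : ℝ → ℝ} (hh : Integrable h gm)
    (hφ : Measurable φ) {M : ℝ} (hM : ∀ x, |φ x| ≤ M) :
    Integrable (fun x => N ρ s h x * φ x) gm ∧
      ∫ x, N ρ s h x * φ x ∂gm = ∫ x, h x * N ρ s φ x ∂gm := by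
  set G : ℝ × ℝ → ℝ := fun p => h p.1 * φ (ρ * p.1 - s * p.2) with hG
  have hGi : Integrable G (gm.prod gm) := by
    have h1 : Integrable (fun p : ℝ × ℝ => h p.1) (gm.prod gm) := hh.comp_fst gm
    refine h1.mul_bdd (c := M) ?_ (Eventually.of_forall fun p => hM _)
    exact (hφ.comp (by fun_prop)).aestronglyMeasurable
  have hR := gm_rot ρ s hρs
  have hGR : ∀ p : ℝ × ℝ, G (ρ * p.1 + s * p.2, -s * p.1 + ρ * p.2)
      = h (ρ * p.1 + s * p.2) * φ p.1 := by
    intro p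
    simp only [hG]
    congr 2
    linear_combination p.1 * hρs
  have hGRi : Integrable (fun p : ℝ × ℝ => h (ρ * p.1 + s * p.2) * φ p.1) (gm.prod gm) := by
    refine (hR.integrable_comp_of_integrable hGi).congr (Eventually.of_forall fun p => ?_)
    exact hGR p
  have e1 : ∀ x, ∫ y, h (ρ * x + s * y) * φ x ∂gm = N ρ s h x * φ x := fun x => by
    rw [integral_mul_const, N]
  have e2 : ∀ x, ∫ y, G (x, y) ∂gm = h x * N ρ s φ x := fun x => by
    simp only [hG]
    rw [integral_const_mul, N]
    congr 1
    have : ∫ y, φ (ρ * x + s * y) ∂(gm.map (fun x => -x)) = ∫ y, φ (ρ * x + s * -y) ∂gm :=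
      integral_map (by fun_prop) (hφ.comp (by fun_prop)).aestronglyMeasurable
    rw [gm_neg.map_eq] at this
    rw [this]
    congr 1
    ext y
    congr 1
    ring
  constructor
  · have := hGRi.integral_prod_left
    simpa only [e1] using this
  · have h1 := integral_prod _ hGRi
    have h2 := integral_prod _ hGi
    simp only [e1] at h1
    simp only [e2] at h2
    rw [← h1, ← h2]
    have h3 : ∫ p, G p ∂((gm.prod gm).map _) = _ :=
      integral_map hR.aemeasurable (by rw [hR.map_eq]; exact hGi.aestronglyMeasurable)
    rw [hR.map_eq] at h3
    rw [h3]
    simp only [hGR]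

/-- Young's inequality for the entropy. -/
lemma young (a b : ℝ) (ha : 0 ≤ a) : a * b ≤ a * log a - a + exp b := by
  rcases ha.eq_or_lt with rfl | ha
  · simpa using (exp_pos b).le
  · have := add_one_le_exp (b - log a)
    rw [exp_sub, exp_log ha, le_div_iff₀ ha] at this
    linarith

lemma dv (ρ s : ℝ) (hρ : 0 < ρ) (hs : s ≠ 0) (hρs : ρ ^ 2 + s ^ 2 = 1) {h φ : ℝ → ℝ}
    (h0 : ∀ x, 0 ≤ h x) (hh : Integrable h gm) (hl : Integrable (fun x => h x * log (h x)) gm)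
    (hc : 0 < ∫ x, h x ∂gm)
    (hφ : Measurable φ) {M : ℝ} (hM : ∀ x, |φ x| ≤ M) :
    ∫ x, N ρ s h x * φ x ∂gm ≤ ρ ^ 2 * ((∫ x, h x * log (h x) ∂gm)
        - (∫ x, h x ∂gm) * log (∫ x, h x ∂gm))
      + (∫ x, h x ∂gm) * log (∫ x, exp (φ x) ∂gm) := by
  set c := ∫ x, h x ∂gm with hcdef
  have hst := star ρ s hρ hs hρs hφ hM
  set C := ∫ x, exp (N ρ s φ x / ρ ^ 2) ∂gm with hC
  have hρ2 : 0 < ρ ^ 2 := by positivity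
  have hNb := N_bound ρ s hM
  have hNm := N_meas ρ s hφ
  have hEb : ∀ x, |exp (N ρ s φ x / ρ ^ 2)| ≤ exp (M / ρ ^ 2) := fun x => by
    rw [abs_of_pos (exp_pos _)]
    exact exp_le_exp.2 (div_le_div_of_nonneg_right ((le_abs_self _).trans (hNb x)) hρ2.le)
  have hEi := integrable_bdd gm (hNm.div_const _).exp hEb
  have hCpos : 0 < C := integral_exp_pos hEi
  have hhN : Integrable (fun x => h x * N ρ s φ x) gm :=
    hh.mul_bdd (c := M) hNm.aestronglyMeasurable (Eventually.of_forall hNb)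
  have hpt : ∀ x, (h x * N ρ s φ x) / ρ ^ 2 + h x * (log c - log C) ≤
      (h x * log (h x) - h x) + (c / C) * exp (N ρ s φ x / ρ ^ 2) := by
    intro x
    have := young (h x) (N ρ s φ x / ρ ^ 2 + (log c - log C)) (h0 x)
    rw [exp_add, exp_sub, exp_log hc, exp_log hCpos] at this
    calc _ = h x * (N ρ s φ x / ρ ^ 2 + (log c - log C)) := by ring
      _ ≤ _ := this
      _ = _ := by ring
  have i1 := hhN.div_const (ρ ^ 2)
  have i2 := hh.mul_const (log c - log C)
  have i3 : Integrable (fun x => h x * log (h x) - h x) gm := hl.sub hh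
  have i4 := hEi.const_mul (c / C)
  have hm := integral_mono (i1.add i2) (i3.add i4) hpt
  simp only [Pi.add_apply] at hm
  rw [integral_add i1 i2, integral_add i3 i4, integral_sub hl hh, integral_div,
    integral_mul_const, integral_const_mul, ← hC, ← hcdef, div_mul_cancel₀ _ hCpos.ne'] at hm
  rw [(adj ρ s hρs hh hφ hM).2]
  set I := ∫ x, h x * N ρ s φ x ∂gm
  set L := ∫ x, h x * log (h x) ∂gm
  have h1 : I / ρ ^ 2 ≤ L - c * (log c - log C) := by linarith
  rw [div_le_iff₀ hρ2] at h1
  nlinarith [mul_le_mul_of_nonneg_left hst hc.le]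

lemma ae_sec (ρ s : ℝ) (hρs : ρ ^ 2 + s ^ 2 = 1) {h : ℝ → ℝ} (hh : Integrable h gm) :
    ∀ᵐ x ∂gm, Integrable (fun y => h (ρ * x + s * y)) gm := by
  have h1 : Integrable (fun p : ℝ × ℝ => h p.1) (gm.prod gm) := hh.comp_fst gm
  exact ((gm_rot ρ s hρs).integrable_comp_of_integrable h1).prod_right_ae

lemma main_pos (ρ s : ℝ) (hρ : 0 < ρ) (hs : s ≠ 0) (hρs : ρ ^ 2 + s ^ 2 = 1) {h : ℝ → ℝ}
    (h0 : ∀ x, 0 ≤ h x) (hmeas : Measurable h) (hh : Integrable h gm)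
    (hl : Integrable (fun x => h x * log (h x)) gm) (hc : 0 < ∫ x, h x ∂gm) :
    ∫ x, N ρ s h x * log (N ρ s h x) ∂gm ≤ ρ ^ 2 * (∫ x, h x * log (h x) ∂gm)
      + (1 - ρ ^ 2) * (∫ x, h x ∂gm) * log (∫ x, h x ∂gm) := by
  have hdv := fun {φ : ℝ → ℝ} (hφ : Measurable φ) {M : ℝ} (hM : ∀ x, |φ x| ≤ M) =>
    dv ρ s hρ hs hρs h0 hh hl hc hφ hM
  have hNm := N_meas ρ s hmeas
  have hN0 : ∀ x, 0 ≤ N ρ s h x := fun x => integral_nonneg fun y => h0 _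
  obtain ⟨hNi, hNint⟩ := adj ρ s hρs hh (φ := fun _ => 1) measurable_const (M := 1) (by simp)
  simp only [mul_one] at hNi hNint
  have hone : ∀ x, N ρ s (fun _ => 1) x = 1 := fun x => by simp [N]
  simp only [hone, mul_one] at hNint
  set c := ∫ x, h x ∂gm with hcdef
  set L := ∫ x, h x * log (h x) ∂gm
  set g := N ρ s h with hg
  have hint : Integrable (fun x => g x * log (g x)) gm := by
    obtain ⟨hJ, -⟩ := adj ρ s hρs hl (φ := fun _ => 1) measurable_const (M := 1) (by simp)
    simp only [mul_one] at hJ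
    refine (hJ.abs.add (integrable_const 1)).mono'
      (hNm.mul hNm.log).aestronglyMeasurable ?_
    filter_upwards [ae_sec ρ s hρs hh, ae_sec ρ s hρs hl] with x h1 h2
    have hj : g x * log (g x) ≤ N ρ s (fun x => h x * log (h x)) x :=
      Real.convexOn_mul_log.map_integral_le Real.continuous_mul_log.continuousOn isClosed_Ici
        (Eventually.of_forall fun y => h0 _) h1 h2
    have hlow := young (g x) 0 (hN0 x)
    have hb := young (g x) (log (g x)) (hN0 x)
    have hlow2 : -1 ≤ g x * log (g x) := by
      have := young (g x) 0 (hN0 x)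
      rw [mul_zero, exp_zero] at this
      have := hN0 x
      linarith
    have := le_abs_self (N ρ s (fun x => h x * log (h x)) x)
    have := abs_nonneg (N ρ s (fun x => h x * log (h x)) x)
    simp only [Pi.add_apply, norm_eq_abs]
    rw [abs_le]
    constructor <;> linarith
  set K : ℕ → ℝ → ℝ := fun n x => max (exp (-n)) (min (g x) (exp n)) with hK
  have hKpos : ∀ n x, 0 < K n x := fun n x => lt_max_of_lt_left (exp_pos _)
  have hKm : ∀ n, Measurable (K n) := fun n => measurable_const.max (hNm.min measurable_const)
  have hKlow : ∀ (n : ℕ) x, exp (-n) ≤ K n x := fun n x => le_max_left _ _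
  have hKup : ∀ (n : ℕ) x, K n x ≤ exp n := fun n x =>
    max_le (exp_le_exp.2 (by have : (0:ℝ) ≤ n := n.cast_nonneg; linarith)) (min_le_right _ _)
  have hlogb : ∀ (n : ℕ) x, |log (K n x)| ≤ n := by
    intro n x
    rw [abs_le]
    exact ⟨(le_log_iff_exp_le (hKpos n x)).2 (hKlow n x),
      (log_le_iff_le_exp (hKpos n x)).2 (hKup n x)⟩
  have hKlim : ∀ x, 0 < g x → ∀ᶠ n : ℕ in atTop, K n x = g x := by
    intro x hx
    have h1 : ∀ᶠ n : ℕ in atTop, |log (g x)| < n :=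
      tendsto_natCast_atTop_atTop.eventually_gt_atTop _
    filter_upwards [h1] with n hn
    rw [abs_lt] at hn
    have h2 : exp (-n) < g x := (lt_log_iff_exp_lt hx).1 hn.1
    have h3 : g x < exp n := (log_lt_iff_lt_exp hx).1 hn.2
    simp only [hK]
    rw [min_eq_left h3.le, max_eq_right h2.le]
  have hKt : ∀ x, Tendsto (fun n => K n x) atTop (𝓝 (g x)) := by
    intro x
    rcases (hN0 x).eq_or_lt with hx | hx
    · have : ∀ n, K n x = exp (-(n:ℝ)) := fun n => by
        simp only [hK]
        rw [← hx, min_eq_left (exp_pos _).le, max_eq_left (exp_pos _).le]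
      simp only [this]
      rw [← hx]
      exact tendsto_exp_atBot.comp (tendsto_neg_atTop_atBot.comp tendsto_natCast_atTop_atTop)
    · exact tendsto_const_nhds.congr' ((hKlim x hx).mono fun n hn => hn.symm)
  have hKabs : ∀ n x, |K n x| ≤ g x + 1 := by
    intro n x
    rw [abs_of_pos (hKpos n x)]
    refine max_le ?_ ((min_le_left _ _).trans (by linarith))
    have : exp (-(n:ℝ)) ≤ 1 := exp_le_one_iff.2 (by simp)
    have := hN0 x
    linarith
  have lim1 : Tendsto (fun n => ∫ x, K n x ∂gm) atTop (𝓝 c) := by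
    rw [← hNint]
    refine tendsto_integral_of_dominated_convergence (fun x => g x + 1)
      (fun n => (hKm n).aestronglyMeasurable) (hNi.add (integrable_const _))
      (fun n => Eventually.of_forall fun x => hKabs n x)
      (Eventually.of_forall hKt)
  have lim2 : Tendsto (fun n => ∫ x, g x * log (K n x) ∂gm) atTop
      (𝓝 (∫ x, g x * log (g x) ∂gm)) := by
    refine tendsto_integral_of_dominated_convergence (fun x => |g x * log (g x)|)
      (fun n => (hNm.mul (hKm n).log).aestronglyMeasurable) hint.abs ?_ ?_
    · intro n
      refine Eventually.of_forall fun x => ?_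
      rw [norm_eq_abs, abs_mul, abs_mul]
      rcases (hN0 x).eq_or_lt with hx | hx
      · rw [← hx]; simp
      · refine mul_le_mul_of_nonneg_left ?_ (abs_nonneg _)
        have hn0 : (0:ℝ) ≤ n := n.cast_nonneg
        rcases le_total 1 (g x) with h1 | h1
        · have h2 : 1 ≤ K n x := le_max_of_le_right (le_min h1 (one_le_exp hn0))
          have h3 : K n x ≤ g x :=
            max_le ((exp_le_one_iff.2 (by linarith)).trans h1) (min_le_left _ _)
          rw [abs_of_nonneg (log_nonneg h2), abs_of_nonneg (log_nonneg h1)]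
          exact log_le_log (hKpos n x) h3
        · have h2 : K n x ≤ 1 :=
            max_le (exp_le_one_iff.2 (by linarith)) ((min_le_left _ _).trans h1)
          have h3 : g x ≤ K n x :=
            le_max_of_le_right (le_min le_rfl (h1.trans (one_le_exp hn0)))
          rw [abs_of_nonpos (log_nonpos (hKpos n x).le h2), abs_of_nonpos (log_nonpos hx.le h1)]
          exact neg_le_neg (log_le_log hx h3)
    · refine Eventually.of_forall fun x => ?_
      rcases (hN0 x).eq_or_lt with hx | hx
      · rw [← hx]; simp
      · exact tendsto_const_nhds.congr' ((hKlim x hx).mono fun n hn => by simp only [hn])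
  have hle : ∀ n, ∫ x, g x * log (K n x) ∂gm ≤
      ρ ^ 2 * (L - c * log c) + c * log (∫ x, K n x ∂gm) := by
    intro n
    have := hdv (hKm n).log (hlogb n)
    simp only [exp_log (hKpos n _)] at this
    exact this
  have lim3 := ((lim1.log hc.ne').const_mul c).const_add (ρ ^ 2 * (L - c * log c))
  have := le_of_tendsto_of_tendsto' lim2 lim3 hle
  linarith

end OUEntropy

/-- Entropic version of Nelson's hypercontractive estimate. For the
Ornstein–Uhlenbeck semigroup `N_t h(x) = ∫ h(e^{-t}x + √(1-e^{-2t})y) e^{-πy²} dy` and a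
nonnegative `h ∈ L¹(ℝ, e^{-πx²}dx)` with finite entropy, for all `t ≥ 0`:
`S(N_t h) ≤ e^{-2t} S(h) + (1 - e^{-2t}) ‖h‖₁ log ‖h‖₁`. -/
theorem ornstein_uhlenbeck_entropy_decay
    (h : ℝ → ℝ) (hh_nonneg : ∀ x, 0 ≤ h x) (hh_meas : Measurable h)
    (hh_int : Integrable (fun x => h x * Real.exp (-π * x ^ 2)))
    (hh_ent : Integrable (fun x => h x * Real.log (h x) * Real.exp (-π * x ^ 2)))
    (t : ℝ) (ht : 0 ≤ t) :
    (∫ x : ℝ,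
        (∫ y : ℝ, h (Real.exp (-t) * x + Real.sqrt (1 - Real.exp (-2 * t)) * y) *
          Real.exp (-π * y ^ 2)) *
        Real.log (∫ y : ℝ, h (Real.exp (-t) * x + Real.sqrt (1 - Real.exp (-2 * t)) * y) *
          Real.exp (-π * y ^ 2)) *
        Real.exp (-π * x ^ 2))
      ≤ Real.exp (-2 * t) * (∫ x : ℝ, h x * Real.log (h x) * Real.exp (-π * x ^ 2))
        + (1 - Real.exp (-2 * t)) *
            (∫ x : ℝ, h x * Real.exp (-π * x ^ 2)) *
            Real.log (∫ x : ℝ, h x * Real.exp (-π * x ^ 2)) := by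
  have hS : ∀ (h : ℝ → ℝ) (ρ s x : ℝ), ∫ y : ℝ, h (ρ * x + s * y) * Real.exp (-π * y ^ 2)
      = OUEntropy.N ρ s h x := fun h ρ s x => by
    rw [OUEntropy.N, OUEntropy.gm_integral]
  rcases ht.eq_or_lt with rfl | ht
  · simp only [neg_zero, mul_zero, Real.exp_zero, sub_self, Real.sqrt_zero, zero_mul, add_zero,
      one_mul]
    have : ∀ x, ∫ y : ℝ, h x * Real.exp (-π * y ^ 2) = h x := fun x => by
      rw [integral_const_mul, OUEntropy.gm_univ_exp, mul_one]
    simp only [this]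
    exact le_rfl
  have hρ : 0 < Real.exp (-t) := Real.exp_pos _
  have hρ2 : Real.exp (-2 * t) = Real.exp (-t) ^ 2 := by
    rw [sq, ← Real.exp_add]
    congr 1
    ring
  have hlt : 0 < 1 - Real.exp (-2 * t) := by
    have : Real.exp (-2 * t) < 1 := by
      rw [← Real.exp_zero]
      exact Real.exp_lt_exp.2 (by linarith)
    linarith
  have hs : Real.sqrt (1 - Real.exp (-2 * t)) ≠ 0 := (Real.sqrt_pos.2 hlt).ne'
  have hρs : Real.exp (-t) ^ 2 + Real.sqrt (1 - Real.exp (-2 * t)) ^ 2 = 1 := by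
    rw [Real.sq_sqrt hlt.le, hρ2]
    ring
  simp only [hS]
  rw [← OUEntropy.gm_integrable] at hh_int hh_ent
  rw [← OUEntropy.gm_integral, ← OUEntropy.gm_integral, ← OUEntropy.gm_integral]
  generalize Real.sqrt (1 - Real.exp (-2 * t)) = s at *
  rw [hρ2]
  rcases (integral_nonneg (μ := OUEntropy.gm) (f := h) hh_nonneg).eq_or_lt with hc | hc
  · obtain ⟨hNi, hNint⟩ := OUEntropy.adj _ s hρs hh_int (φ := fun _ => 1) measurable_const
      (M := 1) (by simp)
    have hone : ∀ x, OUEntropy.N (Real.exp (-t)) s (fun _ => 1) x = 1 := fun x => by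
      simp [OUEntropy.N]
    simp only [hone, mul_one, ← hc] at hNi hNint
    have h1 := (integral_eq_zero_iff_of_nonneg (f := h) hh_nonneg hh_int).1 hc.symm
    have h2 := (integral_eq_zero_iff_of_nonneg
      (fun x => integral_nonneg fun y => hh_nonneg _) hNi).1 hNint
    have e1 : ∫ x, h x * Real.log (h x) ∂OUEntropy.gm = 0 :=
      integral_eq_zero_of_ae (h1.mono fun x hx => by
        have hx' : h x = 0 := hx
        simp [hx'])
    have e2 : ∫ x, OUEntropy.N (Real.exp (-t)) s h x *
        Real.log (OUEntropy.N (Real.exp (-t)) s h x) ∂OUEntropy.gm = 0 :=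
      integral_eq_zero_of_ae (h2.mono fun x hx => by
        have hx' : OUEntropy.N (Real.exp (-t)) s h x = 0 := hx
        simp [hx'])
    rw [← hc, e1, e2]
    simp
  · exact OUEntropy.main_pos _ s hρ hs hρs hh_nonneg hh_meas hh_int hh_ent hc
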